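/- arXiv:1009.2472 — 2 statements merged into one kernel-verified Lean document; each statement's English description precedes it below -/
import Mathlib

section
/- There exists a constant κ > 0, depending at most on the dimension d ≥ 2, with the following property: if a nonempty open set D ⊆ ℝ^d is of class C^{1,1} at scale r > 0 and Q ∈ ∂D, then there exists a bounded open connected set F ⊆ D which is C^{1,1} at every scale s < κr, has diam(F) < 2r, and satisfies D ∩ B(Q, r/4) = F ∩ B(Q, r/4). -/
open Metric Set

/-- `D` is of class `C^{1,1}` at scale `r`: at every boundary point `Q` there are
inner and outer open tangent balls of radius `r`. -/
def C11At (d : ℕ) (D : Set (EuclideanSpace ℝ (Fin d))) (r : ℝ) : Prop :=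
  ∀ Q ∈ frontier D, ∃ x' x'' : EuclideanSpace ℝ (Fin d),
    dist x' Q = r ∧ dist x'' Q = r ∧
    Metric.ball x' r ⊆ D ∧ Metric.ball x'' r ⊆ Dᶜ

section

variable {E : Type*} [NormedAddCommGroup E]

/-- The distance to the boundary of `D`, counted positively in `D` and negatively outside. -/
noncomputable def signedInfDist (D : Set E) (x : E) : ℝ := infDist x Dᶜ - infDist x D

lemma signedInfDist_compl (D : Set E) (x : E) : signedInfDist Dᶜ x = -signedInfDist D x := by
  simp [signedInfDist]

lemma continuous_signedInfDist (D : Set E) : Continuous (signedInfDist D) :=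
  (continuous_infDist_pt _).sub (continuous_infDist_pt _)

lemma signedInfDist_of_mem {D : Set E} {x : E} (hx : x ∈ D) : signedInfDist D x = infDist x Dᶜ := by
  simp [signedInfDist, infDist_zero_of_mem hx]

lemma signedInfDist_of_notMem {D : Set E} {x : E} (hx : x ∉ D) : signedInfDist D x = -infDist x D := by
  simp [signedInfDist, infDist_zero_of_mem (show x ∈ Dᶜ from hx)]

lemma infDist_le_dist_of_mem_closure {D : Set E} {x y : E} (hy : y ∈ closure D) :
    infDist x D ≤ dist x y := by
  rw [← infDist_closure]
  exact infDist_le_dist_of_mem hy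

lemma abs_signedInfDist_le_dist {D : Set E} {Q : E} (hQ : Q ∈ frontier D) (x : E) :
    |signedInfDist D x| ≤ dist x Q := by
  rw [frontier_eq_closure_inter_closure] at hQ
  by_cases hx : x ∈ D
  · rw [signedInfDist_of_mem hx, abs_of_nonneg infDist_nonneg]
    exact infDist_le_dist_of_mem_closure hQ.2
  · rw [signedInfDist_of_notMem hx, abs_neg, abs_of_nonneg infDist_nonneg]
    exact infDist_le_dist_of_mem_closure hQ.1

lemma signedInfDist_pos_iff {D : Set E} (hD : IsOpen D) {Q : E} (hQ : Q ∈ frontier D) {x : E} :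
    0 < signedInfDist D x ↔ x ∈ D := by
  rw [frontier_eq_closure_inter_closure] at hQ
  constructor
  · intro h
    by_contra hx
    rw [signedInfDist_of_notMem hx] at h
    linarith [infDist_nonneg (x := x) (s := D)]
  · intro hx
    rw [signedInfDist_of_mem hx]
    exact (hD.isClosed_compl.notMem_iff_infDist_pos (closure_nonempty_iff.1 ⟨Q, hQ.2⟩)).1
      (by simpa using hx)

/-- A ball contained in `D` bounds the signed distance from below, also outside the ball. -/
lemma sub_dist_le_signedInfDist [InnerProductSpace ℝ E] {D : Set E} {c : E} {r : ℝ} (hne : Dᶜ.Nonempty) (hr : 0 < r)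
    (h : ball c r ⊆ D) (y : E) : r - dist y c ≤ signedInfDist D y := by
  by_cases hy : y ∈ D
  · rw [signedInfDist_of_mem hy]
    refine (le_infDist hne).2 fun z hz => ?_
    have h1 : r ≤ dist z c := not_lt.1 fun hlt => hz (h hlt)
    linarith [dist_triangle_left z c y]
  · rw [signedInfDist_of_notMem hy]
    have h1 : r ≤ dist y c := not_lt.1 fun hlt => hy (h hlt)
    have h2 : c + (r / dist y c) • (y - c) ∈ closure (ball c r) := by
      rw [closure_ball c hr.ne', mem_closedBall, dist_eq_norm, add_sub_cancel_left, norm_smul,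
        ← dist_eq_norm y, Real.norm_of_nonneg (by positivity), div_mul_cancel₀ _ (by linarith)]
    have h3 := infDist_le_dist_of_mem_closure (x := y) (closure_mono h h2)
    have e : y - (c + (r / dist y c) • (y - c)) = (1 - r / dist y c) • (y - c) := by module
    have h4 : r / dist y c ≤ 1 := (div_le_one (by linarith)).2 h1
    rw [dist_eq_norm y, e, norm_smul, ← dist_eq_norm y, Real.norm_of_nonneg (by linarith),
      sub_mul, div_mul_cancel₀ _ (by linarith)] at h3
    linarith

/-- Two disjoint balls whose spheres share a point are tangent to each other there. -/
lemma smul_sub_eq_of_disjoint_ball [InnerProductSpace ℝ E] {a b z : E} {ρ σ : ℝ} (hρ : 0 < ρ) (hσ : 0 < σ)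
    (ha : dist a z = ρ) (hb : dist b z = σ) (h : Disjoint (ball a ρ) (ball b σ)) :
    σ • (a - z) = ρ • (z - b) := by
  rw [disjoint_ball_ball_iff hρ hσ] at h
  rw [dist_eq_norm] at ha
  rw [dist_comm, dist_eq_norm] at hb
  have h1 : SameRay ℝ (a - z) (z - b) := by
    rw [sameRay_iff_norm_add]
    refine le_antisymm (norm_add_le _ _) ?_
    rw [sub_add_sub_cancel, ha, hb, ← dist_eq_norm]
    exact h
  rw [sameRay_iff_norm_smul_eq, ha, hb] at h1
  exact h1.symm

/-- Every point with positive signed distance lies on the inner normal at a boundary point. -/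
lemma exists_normal_of_signedInfDist_pos [InnerProductSpace ℝ E] [ProperSpace E] {D : Set E} {r : ℝ} (hr : 0 < r)
    (hD : ∀ Q ∈ frontier D, ∃ x' x'' : E, dist x' Q = r ∧ dist x'' Q = r ∧
      ball x' r ⊆ D ∧ ball x'' r ⊆ Dᶜ)
    (hne : Dᶜ.Nonempty) {x : E} (hx : 0 < signedInfDist D x) :
    ∃ z n : E, ‖n‖ = 1 ∧ x = z + signedInfDist D x • n ∧
      ball (z + r • n) r ⊆ D ∧ ball (z - r • n) r ⊆ Dᶜ := by
  have hxD : x ∈ D := by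
    by_contra h
    rw [signedInfDist_of_notMem h] at hx
    linarith [infDist_nonneg (x := x) (s := D)]
  set ρ := signedInfDist D x with hρ
  have hρ' : ρ = infDist x (closure Dᶜ) := by rw [hρ, signedInfDist_of_mem hxD, infDist_closure]
  obtain ⟨z, hz, hxz⟩ := isClosed_closure.exists_infDist_eq_dist hne.closure x
  rw [← hρ'] at hxz
  have hball : ball x ρ ⊆ D := fun y hy => by
    by_contra hyD
    have h := infDist_le_dist_of_mem (x := x) (subset_closure (show y ∈ Dᶜ from hyD))
    rw [← hρ', dist_comm] at h
    exact absurd hy (not_lt.2 h)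
  have hzf : z ∈ frontier D := by
    rw [frontier_eq_closure_inter_closure]
    refine ⟨closure_mono hball ?_, hz⟩
    rw [closure_ball x hx.ne', mem_closedBall, dist_comm, hxz]
  obtain ⟨x', x'', h', h'', hin, hout⟩ := hD z hzf
  have hdisj : Disjoint D Dᶜ := disjoint_compl_right
  have e1 := smul_sub_eq_of_disjoint_ball hr hr h' h'' (hdisj.mono hin hout)
  have e2 := smul_sub_eq_of_disjoint_ball hx hr hxz.symm h'' (hdisj.mono hball hout)
  have hr0 : r ≠ 0 := hr.ne'
  have hn : r • r⁻¹ • (z - x'') = z - x'' := smul_inv_smul₀ hr0 _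
  refine ⟨z, r⁻¹ • (z - x''), ?_, ?_, ?_, ?_⟩
  · rw [norm_smul, ← dist_eq_norm, dist_comm, h'', norm_inv, Real.norm_of_nonneg hr.le,
      inv_mul_cancel₀ hr0]
  · rw [smul_comm, ← e2, inv_smul_smul₀ hr0, add_sub_cancel]
  · rw [hn, ← smul_right_injective E hr0 e1, add_sub_cancel]
    exact hin
  · rw [hn, sub_sub_cancel]
    exact hout

lemma exists_normal [InnerProductSpace ℝ E] [ProperSpace E] {D : Set E} {r : ℝ} (hr : 0 < r)
    (hD : ∀ Q ∈ frontier D, ∃ x' x'' : E, dist x' Q = r ∧ dist x'' Q = r ∧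
      ball x' r ⊆ D ∧ ball x'' r ⊆ Dᶜ)
    (hne : D.Nonempty) (hne' : Dᶜ.Nonempty) (x : E) :
    ∃ z n : E, ‖n‖ = 1 ∧ x = z + signedInfDist D x • n ∧
      ball (z + r • n) r ⊆ D ∧ ball (z - r • n) r ⊆ Dᶜ := by
  rcases lt_trichotomy (signedInfDist D x) 0 with hx | hx | hx
  · obtain ⟨z, n, hn, hz, hin, hout⟩ := exists_normal_of_signedInfDist_pos (D := Dᶜ) hr
      (fun Q hQ => by
        rw [frontier_compl] at hQ
        obtain ⟨x', x'', h', h'', hin, hout⟩ := hD Q hQ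
        exact ⟨x'', x', h'', h', hout, by rwa [compl_compl]⟩)
      (by rwa [compl_compl]) (x := x) (by rw [signedInfDist_compl]; linarith)
    rw [compl_compl] at hout
    rw [signedInfDist_compl] at hz
    exact ⟨z, -n, by rwa [norm_neg], by rwa [smul_neg, ← neg_smul],
      by rwa [smul_neg, ← sub_eq_add_neg], by rwa [smul_neg, sub_neg_eq_add]⟩
  · have hxf : x ∈ frontier D := by
      rw [frontier_eq_closure_inter_closure, mem_inter_iff, mem_closure_iff_infDist_zero hne,
        mem_closure_iff_infDist_zero hne']
      by_cases h : x ∈ D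
      · exact ⟨infDist_zero_of_mem h, by rwa [signedInfDist_of_mem h] at hx⟩
      · exact ⟨by rwa [signedInfDist_of_notMem h, neg_eq_zero] at hx, infDist_zero_of_mem h⟩
    obtain ⟨x', x'', h', h'', hin, hout⟩ := hD x hxf
    have hr0 : r ≠ 0 := hr.ne'
    have e := smul_right_injective E hr0
      (smul_sub_eq_of_disjoint_ball hr hr h' h'' (disjoint_compl_right.mono hin hout))
    refine ⟨x, r⁻¹ • (x' - x), ?_, by simp [hx], ?_, ?_⟩
    · rw [norm_smul, ← dist_eq_norm, h', norm_inv, Real.norm_of_nonneg hr.le, inv_mul_cancel₀ hr0]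
    · rwa [smul_inv_smul₀ hr0, add_sub_cancel]
    · rwa [smul_inv_smul₀ hr0, e, sub_sub_cancel]
  · exact exists_normal_of_signedInfDist_pos hr hD hne' hx

lemma norm_add_smul_le [InnerProductSpace ℝ E] {n h : E} (hn : ‖n‖ = 1) {t : ℝ} (ht : 0 < t) :
    ‖h + t • n‖ ≤ t + inner ℝ n h + ‖h‖ ^ 2 / (2 * t) := by
  have h1 : ‖h + t • n‖ ^ 2 = ‖h‖ ^ 2 + 2 * t * inner ℝ n h + t ^ 2 := by
    rw [norm_add_sq_real, inner_smul_right, real_inner_comm, norm_smul, hn, Real.norm_of_nonneg ht.le]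
    ring
  have h2 : t + inner ℝ n h + ‖h‖ ^ 2 / (2 * t) = (t ^ 2 + ‖h + t • n‖ ^ 2) / (2 * t) := by
    rw [h1]; field_simp; ring
  rw [h2, le_div_iff₀ (by positivity)]
  nlinarith [sq_nonneg (t - ‖h + t • n‖)]

/-- Tangent balls force a two-sided quadratic expansion of the signed distance. -/
lemma exists_signedInfDist_expansion [InnerProductSpace ℝ E] [ProperSpace E] {D : Set E} {r : ℝ} (hr : 0 < r)
    (hD : ∀ Q ∈ frontier D, ∃ x' x'' : E, dist x' Q = r ∧ dist x'' Q = r ∧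
      ball x' r ⊆ D ∧ ball x'' r ⊆ Dᶜ)
    {Q : E} (hQ : Q ∈ frontier D) {x : E} (hx : |signedInfDist D x| < r) :
    ∃ n : E, ‖n‖ = 1 ∧ ∀ y, |signedInfDist D y - signedInfDist D x - inner ℝ n (y - x)| *
      (2 * (r - |signedInfDist D x|)) ≤ ‖y - x‖ ^ 2 := by
  rw [frontier_eq_closure_inter_closure] at hQ
  have hne : D.Nonempty := closure_nonempty_iff.1 ⟨Q, hQ.1⟩
  have hne' : Dᶜ.Nonempty := closure_nonempty_iff.1 ⟨Q, hQ.2⟩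
  obtain ⟨z, n, hn, hz, hin, hout⟩ := exists_normal hr hD hne hne' x
  set ρ := signedInfDist D x
  refine ⟨n, hn, fun y => ?_⟩
  have hρ := abs_lt.1 hx
  have l1 := sub_dist_le_signedInfDist hne' hr hin y
  have l2 := sub_dist_le_signedInfDist (D := Dᶜ) (by rwa [compl_compl]) hr hout y
  rw [signedInfDist_compl] at l2
  have e1 : y - (z + r • n) = (y - x) + (r - ρ) • -n := by
    conv_rhs => rw [hz]
    module
  have e2 : y - (z - r • n) = (y - x) + (r + ρ) • n := by
    conv_rhs => rw [hz]
    module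
  have b1 := norm_add_smul_le (h := y - x) (n := -n) (by rwa [norm_neg]) (t := r - ρ) (by linarith)
  have b2 := norm_add_smul_le (h := y - x) hn (t := r + ρ) (by linarith)
  rw [dist_eq_norm, e1] at l1
  rw [dist_eq_norm, e2] at l2
  rw [inner_neg_left] at b1
  have c1 : ‖y - x‖ ^ 2 / (2 * (r - ρ)) ≤ ‖y - x‖ ^ 2 / (2 * (r - |ρ|)) := by
    gcongr
    exact le_abs_self ρ
  have c2 : ‖y - x‖ ^ 2 / (2 * (r + ρ)) ≤ ‖y - x‖ ^ 2 / (2 * (r - |ρ|)) := by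
    gcongr
    linarith [neg_abs_le ρ]
  rw [← le_div_iff₀ (by linarith), abs_le]
  constructor <;> linarith

/-- At every point of the unit ball, `f` has a quadratic expansion with a unit gradient. -/
def HasQuadraticExpansion [InnerProductSpace ℝ E] (f : E → ℝ) : Prop :=
  ∀ X : E, ‖X‖ < 1 → ∃ n : E, ‖n‖ = 1 ∧
    ∀ Y, |f Y - f X - inner ℝ n (Y - X)| * (2 * (1 - ‖X‖)) ≤ ‖Y - X‖ ^ 2

/-- `f` minus a steep `C^{1,1}` penalty that vanishes on the ball of radius `1 / 4`. -/
noncomputable def penalized (f : E → ℝ) (X : E) : ℝ :=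
  f X - 400 * (max (‖X‖ ^ 2 - 1 / 16) 0) ^ 2

lemma continuous_penalized {f : E → ℝ} (hf : Continuous f) : Continuous (penalized f) := by
  unfold penalized
  fun_prop

lemma penalized_le {f : E → ℝ} {X : E} : penalized f X ≤ f X := by
  unfold penalized
  linarith [sq_nonneg (max (‖X‖ ^ 2 - 1 / 16) 0)]

lemma penalized_eq_of_norm_le {f : E → ℝ} {X : E} (hX : ‖X‖ ≤ 1 / 4) : penalized f X = f X := by
  rw [penalized, max_eq_right (by nlinarith [norm_nonneg X])]
  ring

lemma norm_le_of_penalized_nonneg {f : E → ℝ} (hf : ∀ X, |f X| ≤ ‖X‖) {X : E}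
    (hX : 0 ≤ penalized f X) : ‖X‖ ≤ 3 / 10 := by
  by_contra! h
  have h1 := (le_abs_self _).trans (hf X)
  have h2 : (0 : ℝ) < ‖X‖ ^ 2 - 1 / 16 := by nlinarith
  rw [penalized, max_eq_left h2.le] at hX
  have h3 : 11 / 120 * ‖X‖ ≤ ‖X‖ ^ 2 - 1 / 16 := by nlinarith
  have h4 : 11 / 400 ≤ ‖X‖ ^ 2 - 1 / 16 := by nlinarith
  nlinarith [mul_le_mul h4 h3 (by positivity) h2.le]

lemma sq_max_add_bounds (g v : ℝ) :
    max g 0 ^ 2 + 2 * max g 0 * v ≤ max (g + v) 0 ^ 2 ∧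
      max (g + v) 0 ^ 2 ≤ max g 0 ^ 2 + 2 * max g 0 * v + v ^ 2 := by
  rcases max_cases g 0 with ⟨h1, h1'⟩ | ⟨h1, h1'⟩ <;>
    rcases max_cases (g + v) 0 with ⟨h2, h2'⟩ | ⟨h2, h2'⟩ <;> rw [h1, h2] <;>
    constructor <;> nlinarith [sq_nonneg v]

lemma penalized_expansion [InnerProductSpace ℝ E] {f : E → ℝ} {X n : E} (hX : ‖X‖ ≤ 3 / 10)
    (h : ∀ Y, |f Y - f X - inner ℝ n (Y - X)| * (2 * (1 - ‖X‖)) ≤ ‖Y - X‖ ^ 2) (Y : E) :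
    penalized f Y ≤ penalized f X +
      inner ℝ (n - (1600 * max (‖X‖ ^ 2 - 1 / 16) 0) • X) (Y - X) + 5 / 7 * ‖Y - X‖ ^ 2 ∧
    (‖Y - X‖ ≤ 1 → penalized f X +
      inner ℝ (n - (1600 * max (‖X‖ ^ 2 - 1 / 16) 0) • X) (Y - X) - 1100 * ‖Y - X‖ ^ 2
        ≤ penalized f Y) := by
  have hY := h Y
  have ha := abs_nonneg (f Y - f X - inner ℝ n (Y - X))
  have hf : |f Y - f X - inner ℝ n (Y - X)| ≤ 5 / 7 * ‖Y - X‖ ^ 2 := by nlinarith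
  have hf' := abs_le.1 hf
  have e : ‖Y‖ ^ 2 - 1 / 16 =
      (‖X‖ ^ 2 - 1 / 16) + (2 * inner ℝ X (Y - X) + ‖Y - X‖ ^ 2) := by
    have := norm_add_sq_real X (Y - X)
    rw [add_sub_cancel] at this
    linarith
  have hb := sq_max_add_bounds (‖X‖ ^ 2 - 1 / 16) (2 * inner ℝ X (Y - X) + ‖Y - X‖ ^ 2)
  rw [← e] at hb
  have hm0 : 0 ≤ max (‖X‖ ^ 2 - 1 / 16) 0 := le_max_right _ _
  have hm1 : max (‖X‖ ^ 2 - 1 / 16) 0 ≤ 11 / 400 :=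
    max_le (by nlinarith [norm_nonneg X]) (by norm_num)
  rw [penalized, penalized, inner_sub_left, real_inner_smul_left]
  set m := max (‖X‖ ^ 2 - 1 / 16) 0
  have hh := sq_nonneg ‖Y - X‖
  constructor
  · nlinarith [mul_nonneg hm0 hh]
  · intro hle
    have hi := abs_real_inner_le_norm X (Y - X)
    have hv : (2 * inner ℝ X (Y - X) + ‖Y - X‖ ^ 2) ^ 2 ≤ (8 / 5 * ‖Y - X‖) ^ 2 := by
      refine sq_le_sq' ?_ ?_ <;>
        nlinarith [abs_le.1 hi, norm_nonneg (Y - X), norm_nonneg X,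
          mul_le_mul_of_nonneg_right hX (norm_nonneg (Y - X))]
    nlinarith [mul_le_mul_of_nonneg_right hm1 hh]

lemma isConnected_penalized_pos [InnerProductSpace ℝ E] {f : E → ℝ} (hf : ∀ X, |f X| ≤ ‖X‖)
    (hexp : HasQuadraticExpansion f) : IsConnected {X | 0 < penalized f X} := by
  obtain ⟨n, hn, h⟩ := hexp 0 (by simp)
  have hf0 : f 0 = 0 := by simpa using hf 0
  set c : E := (1 / 4 : ℝ) • n with hc
  have hcn : ‖c‖ = 1 / 4 := by simp [hc, norm_smul, hn]
  have hfc : 7 / 32 ≤ penalized f c := by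
    have h1 := h c
    rw [penalized_eq_of_norm_le hcn.le]
    rw [hf0, sub_zero, sub_zero, hcn, norm_zero, hc, inner_smul_right,
      real_inner_self_eq_norm_sq, hn, ← hc] at h1
    linarith [neg_abs_le (f c - 1 / 4 * 1 ^ 2)]
  have hstar : StarConvex ℝ c {X | 0 < penalized f X} := by
    intro X hX a b ha hb hab
    have hXn := norm_le_of_penalized_nonneg hf (le_of_lt hX)
    have hX' : 0 < penalized f X := hX
    set w := a • c + b • X with hw
    have hwn : ‖w‖ ≤ 3 / 10 := by
      refine (norm_add_le _ _).trans ?_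
      rw [norm_smul a c, norm_smul b X, Real.norm_of_nonneg ha, Real.norm_of_nonneg hb, hcn]
      nlinarith
    obtain ⟨p, -, hp⟩ := hexp w (by linarith)
    have u1 := (penalized_expansion hwn hp c).1
    have u2 := (penalized_expansion hwn hp X).1
    have e1 : c - w = b • (c - X) := by
      have : b = 1 - a := by linarith
      rw [hw, this]; module
    have e2 : X - w = (-a) • (c - X) := by
      have : b = 1 - a := by linarith
      rw [hw, this]; module
    rw [e1, inner_smul_right, norm_smul, mul_pow, Real.norm_eq_abs, sq_abs] at u1
    rw [e2, inner_smul_right, norm_smul, mul_pow, Real.norm_eq_abs, sq_abs] at u2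
    have hcX : ‖c - X‖ ^ 2 ≤ 121 / 400 := by
      have := norm_sub_le c X
      nlinarith [norm_nonneg (c - X)]
    have h1 := mul_le_mul_of_nonneg_left u1 ha
    have h2 := mul_le_mul_of_nonneg_left u2 hb
    have h3 : a * penalized f c + b * penalized f X ≤
        penalized f w + 5 / 7 * (a * b * ‖c - X‖ ^ 2) := by
      have : b = 1 - a := by linarith
      subst this
      nlinarith
    have h4 := mul_le_mul_of_nonneg_left hcX (mul_nonneg ha hb)
    have h5 := mul_le_mul_of_nonneg_left hfc ha
    have h6 : a * b ≤ a := by nlinarith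
    show 0 < penalized f w
    rcases hb.eq_or_lt with h0 | h0
    · nlinarith
    · nlinarith [mul_pos h0 hX']
  exact (hstar.isPathConnected (show 0 < penalized f c by linarith)).isConnected

lemma le_norm_gradient [InnerProductSpace ℝ E] {f : E → ℝ} (hf : ∀ X, |f X| ≤ ‖X‖) {X n : E} (hn : ‖n‖ = 1)
    (hX : penalized f X = 0)
    (h : ∀ Y, |f Y - f X - inner ℝ n (Y - X)| * (2 * (1 - ‖X‖)) ≤ ‖Y - X‖ ^ 2) :
    3 / 20 ≤ ‖n - (1600 * max (‖X‖ ^ 2 - 1 / 16) 0) • X‖ := by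
  have hXn := norm_le_of_penalized_nonneg hf hX.ge
  have hm0 : 0 ≤ max (‖X‖ ^ 2 - 1 / 16) 0 := le_max_right _ _
  have hmX : max (‖X‖ ^ 2 - 1 / 16) 0 ≤ ‖X‖ ^ 2 := max_le (by linarith) (sq_nonneg _)
  rw [penalized] at hX
  by_cases hu : 400 * max (‖X‖ ^ 2 - 1 / 16) 0 ≤ 1 / 2
  · have h1 := norm_sub_norm_le n ((1600 * max (‖X‖ ^ 2 - 1 / 16) 0) • X)
    rw [hn, norm_smul, Real.norm_of_nonneg (by positivity)] at h1
    nlinarith [norm_nonneg X]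
  · push Not at hu
    have hX4 : 1 / 4 ≤ ‖X‖ := by
      by_contra! hlt
      rw [max_eq_right (by nlinarith [norm_nonneg X])] at hu
      norm_num at hu
    have h0 := h 0
    rw [show f 0 = 0 by simpa using hf 0, zero_sub, zero_sub, norm_neg, inner_neg_right] at h0
    have ha := abs_nonneg (-f X - -inner ℝ n X)
    have h1 : |-f X - -inner ℝ n X| ≤ 5 / 7 * ‖X‖ ^ 2 := by nlinarith
    have h2 := (abs_le.1 h1).2
    have hq := abs_real_inner_le_norm (n - (1600 * max (‖X‖ ^ 2 - 1 / 16) 0) • X) X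
    have hq' := (abs_le.1 hq).1
    rw [inner_sub_left, real_inner_smul_left, real_inner_self_eq_norm_sq] at hq'
    set m := max (‖X‖ ^ 2 - 1 / 16) 0
    set q := ‖n - (1600 * m) • X‖
    have h3 : (1200 * m - 5 / 7) * ‖X‖ ^ 2 ≤ q * ‖X‖ := by nlinarith
    have h4 : (1200 * m - 5 / 7) * ‖X‖ ≤ q := by
      refine le_of_mul_le_mul_right ?_ (show 0 < ‖X‖ by linarith)
      linarith
    nlinarith

lemma norm_sq_lt_of_mem_ball [InnerProductSpace ℝ E] {x y n : E} {s : ℝ} (hn : ‖n‖ = 1) (hy : y ∈ ball (x + s • n) s) :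
    ‖y - x‖ ^ 2 < 2 * s * inner ℝ n (y - x) := by
  rw [mem_ball, dist_eq_norm, ← sub_sub] at hy
  have h1 : ‖y - x - s • n‖ ^ 2 < s ^ 2 := by
    have := norm_nonneg (y - x - s • n)
    nlinarith
  rw [norm_sub_sq_real, inner_smul_right, norm_smul, hn, real_inner_comm, mul_one,
    Real.norm_eq_abs, sq_abs] at h1
  linarith

/-- At a zero of the penalized function, its sign is constant on each of the two small balls
tangent to each other there. The balls are written as `‖H‖ ^ 2 < 2 * σ * ⟪±n, H⟫`. -/
lemma exists_touching_direction [InnerProductSpace ℝ E] {f : E → ℝ} (hf : ∀ X, |f X| ≤ ‖X‖)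
    (hexp : HasQuadraticExpansion f) {X : E} (hX : penalized f X = 0) :
    ∃ n : E, ‖n‖ = 1 ∧
      (∀ σ : ℝ, 0 < σ → σ ≤ 1 / 20000 → ∀ Y, ‖Y - X‖ ^ 2 < 2 * σ * inner ℝ n (Y - X) →
        0 < penalized f Y) ∧
      (∀ σ : ℝ, 0 < σ → σ ≤ 1 / 20000 → ∀ Y, ‖Y - X‖ ^ 2 < 2 * σ * -inner ℝ n (Y - X) →
        penalized f Y ≤ 0) := by
  have hXn := norm_le_of_penalized_nonneg hf hX.ge
  obtain ⟨p, hp1, hp⟩ := hexp X (by linarith)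
  have hq := le_norm_gradient hf hp1 hX hp
  have hE := penalized_expansion hXn hp
  rw [hX] at hE
  set q := p - (1600 * max (‖X‖ ^ 2 - 1 / 16) 0) • X
  have hq0 : 0 < ‖q‖ := by linarith
  have hn : ‖‖q‖⁻¹ • q‖ = 1 := by
    rw [norm_smul, norm_inv, norm_norm, inv_mul_cancel₀ hq0.ne']
  have hqi : ∀ H : E, inner ℝ q H = ‖q‖ * inner ℝ (‖q‖⁻¹ • q) H := fun H => by
    rw [real_inner_smul_left, mul_inv_cancel_left₀ hq0.ne']
  refine ⟨‖q‖⁻¹ • q, hn, fun σ hσ hσ' Y hY => ?_, fun σ hσ hσ' Y hY => ?_⟩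
  · have hi := abs_real_inner_le_norm (‖q‖⁻¹ • q) (Y - X)
    rw [hn, one_mul] at hi
    have hE' := hE Y
    rw [hqi] at hE'
    set i := inner ℝ (‖q‖⁻¹ • q) (Y - X)
    have hi0 : 0 < i := by
      by_contra! hle
      nlinarith [sq_nonneg ‖Y - X‖]
    have hle : ‖Y - X‖ ≤ 1 := by
      nlinarith [norm_nonneg (Y - X), (abs_le.1 hi).2]
    have := hE'.2 hle
    nlinarith
  · have hE' := (hE Y).1
    rw [hqi] at hE'
    set i := inner ℝ (‖q‖⁻¹ • q) (Y - X)
    have hi0 : 0 < -i := by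
      by_contra! hle
      nlinarith [sq_nonneg ‖Y - X‖]
    nlinarith

end

/-- localization lemma: there is `κ > 0`, depending at most on `d`,
such that whenever a nonempty open `D ⊆ ℝ^d` is `C^{1,1}` at scale `r > 0` and
`Q ∈ ∂D`, there is a bounded open connected `F ⊆ D`, `C^{1,1}` at every scale
`s < κ r`, with `diam F < 2r` and `D ∩ B(Q, r/4) = F ∩ B(Q, r/4)`. -/
theorem stmt_7 (d : ℕ) (hd : 2 ≤ d) :
    ∃ κ : ℝ, 0 < κ ∧
      ∀ (D : Set (EuclideanSpace ℝ (Fin d))) (r : ℝ), 0 < r →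
        IsOpen D → D.Nonempty → C11At d D r →
        ∀ Q ∈ frontier D,
          ∃ F : Set (EuclideanSpace ℝ (Fin d)),
            IsOpen F ∧ IsConnected F ∧ Bornology.IsBounded F ∧ F ⊆ D ∧
            (∀ s : ℝ, 0 < s → s < κ * r → C11At d F s) ∧
            Metric.diam F < 2 * r ∧
            D ∩ Metric.ball Q (r / 4) = F ∩ Metric.ball Q (r / 4) := by
  refine ⟨1 / 20000, by norm_num, fun D r hr hDo _ hD Q hQ => ?_⟩
  set f : EuclideanSpace ℝ (Fin d) → ℝ := fun X => r⁻¹ * signedInfDist D (Q + r • X) with hf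
  have hr0 : r ≠ 0 := hr.ne'
  have hfle : ∀ X, |f X| ≤ ‖X‖ := fun X => by
    have h := abs_signedInfDist_le_dist hQ (Q + r • X)
    rw [dist_eq_norm, add_sub_cancel_left, norm_smul, Real.norm_of_nonneg hr.le] at h
    rw [hf]
    simp only
    rw [abs_mul, abs_of_pos (inv_pos.2 hr), inv_mul_le_iff₀ hr]
    exact h
  have hfexp : HasQuadraticExpansion f := fun X hX => by
    have hlt : |signedInfDist D (Q + r • X)| ≤ r * ‖X‖ := by
      have h := abs_signedInfDist_le_dist hQ (Q + r • X)
      rwa [dist_eq_norm, add_sub_cancel_left, norm_smul, Real.norm_of_nonneg hr.le] at h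
    obtain ⟨n, hn, h⟩ := exists_signedInfDist_expansion hr hD hQ (x := Q + r • X) (by nlinarith)
    refine ⟨n, hn, fun Y => ?_⟩
    have h1 := h (Q + r • Y)
    have e : Q + r • Y - (Q + r • X) = r • (Y - X) := by module
    rw [e, inner_smul_right, norm_smul, Real.norm_of_nonneg hr.le] at h1
    have e2 : signedInfDist D (Q + r • Y) - signedInfDist D (Q + r • X) - r * inner ℝ n (Y - X)
        = r * (f Y - f X - inner ℝ n (Y - X)) := by
      simp only [hf]; field_simp
    rw [e2, abs_mul, abs_of_pos hr] at h1
    have h2 := abs_nonneg (f Y - f X - inner ℝ n (Y - X))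
    have h3 : r * (1 - ‖X‖) ≤ r - |signedInfDist D (Q + r • X)| := by linarith
    have h4 := mul_le_mul_of_nonneg_left h3 (mul_nonneg hr.le h2)
    have h5 : (r * r) * (|f Y - f X - inner ℝ n (Y - X)| * (2 * (1 - ‖X‖)))
        ≤ (r * r) * ‖Y - X‖ ^ 2 := by nlinarith
    exact le_of_mul_le_mul_left h5 (mul_pos hr hr)
  have hfcont : Continuous f := by
    have := continuous_signedInfDist D
    fun_prop
  set φ := penalized f with hφ
  have hφcont : Continuous φ := continuous_penalized hfcont
  set T : EuclideanSpace ℝ (Fin d) → EuclideanSpace ℝ (Fin d) := fun x => r⁻¹ • (x - Q) with hT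
  have hTQ : ∀ x, Q + r • T x = x := fun x => by simp [hT, smul_smul, hr0]
  have hTQ' : ∀ X, T (Q + r • X) = X := fun X => by simp [hT, smul_smul, hr0]
  have hTcont : Continuous T := by fun_prop
  have hnT : ∀ x, dist x Q = r * ‖T x‖ := fun x => by
    conv_lhs => rw [← hTQ x]
    rw [dist_eq_norm, add_sub_cancel_left, norm_smul, Real.norm_of_nonneg hr.le]
  have hfT : ∀ x, f (T x) = r⁻¹ * signedInfDist D x := fun x => by simp only [hf, hTQ]
  have hsub : {x | 0 < φ (T x)} ⊆ closedBall Q (3 / 10 * r) := fun x hx => by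
    have := norm_le_of_penalized_nonneg hfle (le_of_lt hx)
    rw [mem_closedBall, hnT]
    nlinarith
  have hpos : ∀ x, 0 < signedInfDist D x ↔ x ∈ D := fun x => signedInfDist_pos_iff hDo hQ
  have hfpos : ∀ x, 0 < f (T x) ↔ x ∈ D := fun x => by
    rw [hfT, ← hpos, mul_pos_iff_of_pos_left (inv_pos.2 hr)]
  refine ⟨{x | 0 < φ (T x)}, isOpen_lt continuous_const (hφcont.comp hTcont), ?_,
    isBounded_closedBall.subset hsub, ?_, ?_, ?_, ?_⟩
  · have himg : {x | 0 < φ (T x)} = (fun X => Q + r • X) '' {X | 0 < φ X} := by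
      ext x
      constructor
      · exact fun hx => ⟨T x, hx, hTQ x⟩
      · rintro ⟨X, hX, rfl⟩
        simpa only [mem_ofPred_eq, hTQ'] using hX
    rw [himg]
    exact (isConnected_penalized_pos hfle hfexp).image _ (by fun_prop)
  · intro x hx
    rw [← hfpos]
    exact penalized_le.trans_lt' hx
  · intro s hs hsκ x hx
    have hx0 : φ (T x) = 0 :=
      (frontier_lt_subset_eq continuous_const (hφcont.comp hTcont) hx).symm
    obtain ⟨n, hn, hin, hout⟩ := exists_touching_direction hfle hfexp hx0
    have hball : ∀ (m : EuclideanSpace ℝ (Fin d)), ‖m‖ = 1 → ∀ y ∈ ball (x + s • m) s,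
        ‖T y - T x‖ ^ 2 < 2 * (s / r) * inner ℝ m (T y - T x) := fun m hm y hy => by
      have h := norm_sq_lt_of_mem_ball hm hy
      have e : y - x = r • (T y - T x) := by
        conv_lhs => rw [← hTQ y, ← hTQ x]
        module
      rw [e, inner_smul_right, norm_smul, Real.norm_of_nonneg hr.le] at h
      have h2 : r ^ 2 * ‖T y - T x‖ ^ 2
          < r ^ 2 * (2 * (s / r) * inner ℝ m (T y - T x)) := by
        have e2 : r ^ 2 * (2 * (s / r) * inner ℝ m (T y - T x))
          = 2 * s * (r * inner ℝ m (T y - T x)) := by field_simp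
        rw [e2]; nlinarith
      exact lt_of_mul_lt_mul_left h2 (by positivity)
    have hsr : s / r ≤ 1 / 20000 := by rw [div_le_iff₀ hr]; exact hsκ.le
    have hsr0 : 0 < s / r := by positivity
    refine ⟨x + s • n, x + s • (-n), ?_, ?_, fun y hy => ?_, fun y hy => ?_⟩
    · simp [dist_eq_norm, norm_smul, hn, abs_of_pos hs]
    · simp [dist_eq_norm, norm_smul, hn, abs_of_pos hs]
    · exact hin _ hsr0 hsr _ (hball n hn y hy)
    · have h := hball (-n) (by simpa using hn) y hy
      rw [inner_neg_left] at h
      exact not_lt.2 (hout _ hsr0 hsr _ h)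
  · calc _ ≤ diam (closedBall Q (3 / 10 * r)) := diam_mono hsub isBounded_closedBall
      _ ≤ 2 * (3 / 10 * r) := diam_closedBall (by positivity)
      _ < 2 * r := by linarith
  · ext x
    simp only [mem_inter_iff, and_congr_left_iff, mem_ofPred_eq, mem_ball]
    intro hx
    have : ‖T x‖ ≤ 1 / 4 := by
      rw [hnT] at hx
      nlinarith
    rw [hφ, penalized_eq_of_norm_le this, hfpos]
end

section
/- Let D ⊆ ℝ^d be a nonempty open set with nonempty complement and write δ(x) for the distance from x to ℝ^d ∖ D. Then for all x, y, z ∈ D with x ≠ y, x ≠ z and y ≠ z: min(δ(z), |x−z|, |y−z|) / ( min(δ(z), |y−z|) · min(δ(x), |x−z|) ) ≤ 2 / min(δ(x), |x−y|). -/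
open Metric Set

/-- If `A ≥ min a t - r`, then `min A r * min a t ≤ 2 * (A * min a r)`. -/
theorem min_mul_min_le_two_mul {A a r t : ℝ} (hA : 0 ≤ A) (ha : 0 ≤ a) (hr : 0 ≤ r)
    (ht : 0 ≤ t) (h : min a t - r ≤ A) :
    min A r * min a t ≤ 2 * (A * min a r) := by
  have hm : 0 ≤ min a t := le_min ha ht
  rcases le_total a r with har | hra
  · rw [min_eq_left har]
    have := mul_le_mul (min_le_left A r) (min_le_left a t) hm hA
    linarith [mul_nonneg hA ha]
  · rw [min_eq_right hra]
    rcases le_total (min a t) (2 * r) with hmr | hmr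
    · have := mul_le_mul (min_le_left A r) hmr hm hA
      linarith
    · have := mul_le_mul (min_le_right A r) (show min a t ≤ 2 * A by linarith) hm hr
      linarith

/-- for `δ = dist(·, ℝ^d ∖ D)` and distinct `x, y, z ∈ D`,
`min(δ(z), |x-z|, |y-z|) / (min(δ(z),|y-z|) · min(δ(x),|x-z|)) ≤ 2 / min(δ(x),|x-y|)`. -/
theorem stmt_19 (d : ℕ) (D : Set (EuclideanSpace ℝ (Fin d))) (hD : IsOpen D)
    (hne : D.Nonempty) (hc : Dᶜ.Nonempty) :
    ∀ x ∈ D, ∀ y ∈ D, ∀ z ∈ D, x ≠ y → x ≠ z → y ≠ z →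
      min (Metric.infDist z Dᶜ) (min (dist x z) (dist y z)) /
          (min (Metric.infDist z Dᶜ) (dist y z) *
            min (Metric.infDist x Dᶜ) (dist x z))
        ≤ 2 / min (Metric.infDist x Dᶜ) (dist x y) := by
  intro x hx y _ z hz hxy hxz hyz
  have hδ : ∀ w ∈ D, 0 < infDist w Dᶜ := fun w hw =>
    (hD.isClosed_compl.notMem_iff_infDist_pos hc).1 (not_not_intro hw)
  have hxz' := dist_pos.2 hxz
  have hA : 0 < min (infDist z Dᶜ) (dist y z) := lt_min (hδ z hz) (dist_pos.2 hyz)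
  have h : min (infDist x Dᶜ) (dist x y) - dist x z ≤ min (infDist z Dᶜ) (dist y z) := by
    have hlip := infDist_le_infDist_add_dist (s := Dᶜ) (x := x) (y := z)
    have htri := dist_triangle_right x y z
    refine le_min ?_ ?_
    · linarith [min_le_left (infDist x Dᶜ) (dist x y)]
    · linarith [min_le_right (infDist x Dᶜ) (dist x y)]
  rw [div_le_div_iff₀ (mul_pos hA (lt_min (hδ x hx) hxz')) (lt_min (hδ x hx) (dist_pos.2 hxy)),
    min_comm (dist x z), ← min_assoc]
  exact min_mul_min_le_two_mul hA.le (hδ x hx).le hxz'.le dist_nonneg h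
end
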